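/- (Backward Darboux transformation for the Hirota–Miwa equation.) Let a_1, a_2, a_3 be nonzero complex numbers and let τ : ℤ³ × ℝ → ℂ be nowhere vanishing, smooth in x, and satisfy the semi-discrete KP equation. Let ρ and ψ be smooth solutions of the backward linear system with potential τ, with ρ nowhere vanishing. Define τ̃ := ρτ and ψ̃ := ψ_x − (ρ_x/ρ)ψ. Then: (a) for each i = 1,2,3, ψ̃ = −a_i(ψ_ī − (ρ_ī/ρ)ψ); (b) τ̃ is nowhere vanishing and satisfies the semi-discrete KP equation; (c) ψ̃ satisfies the backward linear system with potential τ̃, i.e. a_i ψ̃_ī − a_j ψ̃_j̄ = (a_i − a_j)(τ̃_{īj̄}τ̃/(τ̃_ī τ̃_j̄))ψ̃ for 1 ≤ i < j ≤ 3 and ψ̃_x = −a_i ψ̃_ī + ((τ̃_x/τ̃)_ī − τ̃_x/τ̃ + a_i)ψ̃ for i = 1,2,3. -/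

import Mathlib

noncomputable section

/-- Forward shift in the `i`-th discrete direction of `ℤ³`. -/
def fwd (i : Fin 3) (n : Fin 3 → ℤ) : Fin 3 → ℤ := Function.update n i (n i + 1)

/-- Backward shift in the `i`-th discrete direction of `ℤ³`. -/
def bwd (i : Fin 3) (n : Fin 3 → ℤ) : Fin 3 → ℤ := Function.update n i (n i - 1)

/-- The semi-discrete KP equation:
`(a_i − a_j)(τ_{ij}τ − τ_i τ_j) + τ_{i,x} τ_j − τ_i τ_{j,x} = 0` for all `1 ≤ i < j ≤ 3`. -/
def SemiKP (a : Fin 3 → ℂ) (τ : (Fin 3 → ℤ) → ℝ → ℂ) : Prop :=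
  ∀ i j : Fin 3, i < j → ∀ n x,
    (a i - a j) * (τ (fwd i (fwd j n)) x * τ n x - τ (fwd i n) x * τ (fwd j n) x)
      + deriv (τ (fwd i n)) x * τ (fwd j n) x - τ (fwd i n) x * deriv (τ (fwd j n)) x = 0

/-- The forward linear system for `φ` with potential `τ`:
`a_i φ_i − a_j φ_j = (a_i − a_j)(τ_{ij}τ/(τ_i τ_j))φ` for `1 ≤ i < j ≤ 3`, together with
`φ_x = a_i φ_i + ((τ_x/τ)_i − τ_x/τ − a_i)φ` for `i = 1,2,3`. -/
def FwdLin (a : Fin 3 → ℂ) (τ φ : (Fin 3 → ℤ) → ℝ → ℂ) : Prop :=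
  (∀ i j : Fin 3, i < j → ∀ n x,
    a i * φ (fwd i n) x - a j * φ (fwd j n) x
      = (a i - a j) * (τ (fwd i (fwd j n)) x * τ n x / (τ (fwd i n) x * τ (fwd j n) x))
          * φ n x)
  ∧ ∀ i : Fin 3, ∀ n x,
      deriv (φ n) x = a i * φ (fwd i n) x
        + (deriv (τ (fwd i n)) x / τ (fwd i n) x - deriv (τ n) x / τ n x - a i) * φ n x

/-- The backward linear system for `ψ` with potential `τ`:
`a_i ψ_ī − a_j ψ_j̄ = (a_i − a_j)(τ_{īj̄}τ/(τ_ī τ_j̄))ψ` for `1 ≤ i < j ≤ 3`, together with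
`ψ_x = −a_i ψ_ī + ((τ_x/τ)_ī − τ_x/τ + a_i)ψ` for `i = 1,2,3`. -/
def BwdLin (a : Fin 3 → ℂ) (τ ψ : (Fin 3 → ℤ) → ℝ → ℂ) : Prop :=
  (∀ i j : Fin 3, i < j → ∀ n x,
    a i * ψ (bwd i n) x - a j * ψ (bwd j n) x
      = (a i - a j) * (τ (bwd i (bwd j n)) x * τ n x / (τ (bwd i n) x * τ (bwd j n) x))
          * ψ n x)
  ∧ ∀ i : Fin 3, ∀ n x,
      deriv (ψ n) x = -(a i) * ψ (bwd i n) x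
        + (deriv (τ (bwd i n)) x / τ (bwd i n) x - deriv (τ n) x / τ n x + a i) * ψ n x

theorem bwd_fwd (i : Fin 3) (n : Fin 3 → ℤ) : bwd i (fwd i n) = n := by
  simp [bwd, fwd]

theorem fwd_comm {i j : Fin 3} (h : i ≠ j) (n : Fin 3 → ℤ) :
    fwd i (fwd j n) = fwd j (fwd i n) := by
  simp only [fwd, Function.update_of_ne h, Function.update_of_ne h.symm]
  exact Function.update_comm h.symm _ _ _

theorem bwd_comm {i j : Fin 3} (h : i ≠ j) (n : Fin 3 → ℤ) :
    bwd i (bwd j n) = bwd j (bwd i n) := by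
  simp only [bwd, Function.update_of_ne h, Function.update_of_ne h.symm]
  exact Function.update_comm h.symm _ _ _

section Darboux

variable {a : Fin 3 → ℂ} {τ ρ ψ : (Fin 3 → ℤ) → ℝ → ℂ}

theorem BwdLin.darboux_eq (hρ : BwdLin a τ ρ) (hψ : BwdLin a τ ψ) (hρ0 : ∀ n x, ρ n x ≠ 0)
    (i : Fin 3) (n : Fin 3 → ℤ) (x : ℝ) :
    deriv (ψ n) x - deriv (ρ n) x / ρ n x * ψ n x
      = -(a i) * (ψ (bwd i n) x - ρ (bwd i n) x / ρ n x * ψ n x) := by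
  have h0 := hρ0 n x
  rw [hρ.2 i n x, hψ.2 i n x]
  field_simp
  ring

theorem BwdLin.semiKP_mul (hρ : BwdLin a τ ρ) (hτ0 : ∀ n x, τ n x ≠ 0)
    (hτ : ∀ n, Differentiable ℝ (τ n)) (hρd : ∀ n, Differentiable ℝ (ρ n)) :
    SemiKP a (fun n x => ρ n x * τ n x) := by
  intro i j hij n x
  have hdis := hρ.1 i j hij (fwd i (fwd j n)) x
  have hi := hρ.2 i (fwd i n) x
  have hj := hρ.2 j (fwd j n) x
  rw [fwd_comm hij.ne, bwd_fwd, ← fwd_comm hij.ne, bwd_fwd, bwd_fwd] at hdis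
  rw [bwd_fwd] at hi hj
  beta_reduce
  rw [deriv_fun_mul (hρd _ x) (hτ _ x), deriv_fun_mul (hρd _ x) (hτ _ x), hi, hj]
  have h0 := hτ0 n x
  have h1 := hτ0 (fwd i n) x
  have h2 := hτ0 (fwd j n) x
  field_simp at hdis ⊢
  linear_combination (-(τ n x * ρ n x)) * hdis

theorem BwdLin.darboux (hρ : BwdLin a τ ρ) (hψ : BwdLin a τ ψ)
    (hτ0 : ∀ n x, τ n x ≠ 0) (hρ0 : ∀ n x, ρ n x ≠ 0)
    (hτ : ∀ n, Differentiable ℝ (τ n)) (hρd : ∀ n, Differentiable ℝ (ρ n))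
    (hψd : ∀ n, Differentiable ℝ (ψ n)) :
    BwdLin a (fun n x => ρ n x * τ n x)
      (fun n x => deriv (ψ n) x - deriv (ρ n) x / ρ n x * ψ n x) := by
  refine ⟨fun i j hij n x => ?_, fun i n x => ?_⟩
  · have hi := hρ.darboux_eq hψ hρ0 i n x
    have hj := hρ.darboux_eq hψ hρ0 j n x
    have hρij := hρ.1 i j hij n x
    have h0 := hρ0 n x
    have h1 := hρ0 (bwd i n) x
    have h2 := hρ0 (bwd j n) x
    have t1 := hτ0 (bwd i n) x
    have t2 := hτ0 (bwd j n) x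
    beta_reduce
    rw [hρ.darboux_eq hψ hρ0 j (bwd i n) x, hρ.darboux_eq hψ hρ0 i (bwd j n) x,
      ← bwd_comm hij.ne]
    set D := deriv (ψ n) x - deriv (ρ n) x / ρ n x * ψ n x
    have hC : (a i - a j) * (ρ (bwd i (bwd j n)) x * τ (bwd i (bwd j n)) x * (ρ n x * τ n x) /
          (ρ (bwd i n) x * τ (bwd i n) x * (ρ (bwd j n) x * τ (bwd j n) x))) * D
        = ρ (bwd i (bwd j n)) x / (ρ (bwd i n) x * ρ (bwd j n) x) *
          (a i * ρ (bwd i n) x * D - a j * ρ (bwd j n) x * D) := by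
      rw [← sub_mul, hρij]
      field_simp
    rw [hC]
    nth_rewrite 1 [hj]
    rw [hi]
    field_simp
    ring
  · have hfun : (fun y => deriv (ψ n) y - deriv (ρ n) y / ρ n y * ψ n y)
        = fun y => -(a i) * (ψ (bwd i n) y - ρ (bwd i n) y / ρ n y * ψ n y) :=
      funext (hρ.darboux_eq hψ hρ0 i n)
    have hder := (((hψd (bwd i n) x).hasDerivAt.sub
      (((hρd (bwd i n) x).hasDerivAt.div (hρd n x).hasDerivAt (hρ0 n x)).mul
        (hψd n x).hasDerivAt)).const_mul (-(a i))).deriv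
    have hLHS := (congrArg (deriv · x) hfun).trans hder
    simp only [Pi.div_apply] at hLHS
    have h0 := hρ0 n x
    have h1 := hρ0 (bwd i n) x
    have t0 := hτ0 n x
    have t1 := hτ0 (bwd i n) x
    beta_reduce
    rw [hLHS, hρ.darboux_eq hψ hρ0 i n x, deriv_fun_mul (hρd _ x) (hτ _ x),
      deriv_fun_mul (hρd _ x) (hτ _ x), hρ.2 i n x, hψ.2 i n x]
    field_simp
    ring

end Darboux

/-- Backward Darboux transformation for the Hirota–Miwa equation: given a nowhere-vanishing
solution `ρ` and solution `ψ` of the backward linear system with potential `τ`, the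
functions `τ̃ = ρτ` and `ψ̃ = ψ_x − (ρ_x/ρ)ψ` satisfy: (a) `ψ̃ = −a_i(ψ_ī − (ρ_ī/ρ)ψ)` for
each `i`; (b) `τ̃` is nowhere vanishing and satisfies the semi-discrete KP equation;
(c) `ψ̃` satisfies the backward linear system with potential `τ̃`. -/
theorem backward_darboux_hirota_miwa
    (a : Fin 3 → ℂ) (ha : ∀ i, a i ≠ 0)
    (τ ρ ψ : (Fin 3 → ℤ) → ℝ → ℂ)
    (hτ0 : ∀ n x, τ n x ≠ 0)
    (hτsmooth : ∀ n, ContDiff ℝ (⊤ : ℕ∞) (τ n))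
    (hKP : SemiKP a τ)
    (hρsmooth : ∀ n, ContDiff ℝ (⊤ : ℕ∞) (ρ n))
    (hψsmooth : ∀ n, ContDiff ℝ (⊤ : ℕ∞) (ψ n))
    (hρ : BwdLin a τ ρ) (hψ : BwdLin a τ ψ)
    (hρ0 : ∀ n x, ρ n x ≠ 0) :
    (∀ i : Fin 3, ∀ n x,
      deriv (ψ n) x - deriv (ρ n) x / ρ n x * ψ n x
        = -(a i) * (ψ (bwd i n) x - ρ (bwd i n) x / ρ n x * ψ n x))
    ∧ (∀ n x, ρ n x * τ n x ≠ 0)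
    ∧ SemiKP a (fun n x => ρ n x * τ n x)
    ∧ BwdLin a (fun n x => ρ n x * τ n x)
        (fun n x => deriv (ψ n) x - deriv (ρ n) x / ρ n x * ψ n x) := by
  have hτ n := (hτsmooth n).differentiable (by simp)
  have hρd n := (hρsmooth n).differentiable (by simp)
  have hψd n := (hψsmooth n).differentiable (by simp)
  exact ⟨hρ.darboux_eq hψ hρ0, fun n x => mul_ne_zero (hρ0 n x) (hτ0 n x),
    hρ.semiKP_mul hτ0 hτ hρd, hρ.darboux hψ hτ0 hρ0 hτ hρd hψd⟩
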